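/- arXiv:0711.4985 — 6 statements merged into one kernel-verified Lean document; each statement's English description precedes it below -/
import Mathlib

section
/- Let g be a finite-dimensional complex Lie algebra with Killing form B, and let h be a Lie subalgebra of g such that the restriction of B to h × h is non-degenerate. Then h is reductive; that is, the solvable radical of h equals the center of h, and h is the direct sum of its center and a semisimple ideal. -/
namespace LieModule

open LieAlgebra Module

section

variable {k L M : Type*} [Field k] [CharZero k] [LieRing L] [LieAlgebra k L]
  [Module.Finite k L]
  [AddCommGroup M] [Module k M] [LieRingModule L M] [LieModule k L M] [Module.Finite k M]

/-- A nontrivial module over an algebraically closed field of characteristic zero has a nontrivial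
submodule annihilated by every element of the radical which lies in the derived ideal. -/
lemma exists_ne_bot_forall_mem_radical_lie_eq_zero [IsAlgClosed k] [Nontrivial M] :
    ∃ N : LieSubmodule k L M, N ≠ ⊥ ∧
      ∀ x ∈ radical k L, x ∈ lowerCentralSeries k L L 1 → ∀ n ∈ N, ⁅x, n⁆ = 0 := by
  obtain ⟨χ, hχ⟩ : ∃ χ : Module.Dual k (radical k L), Nontrivial (weightSpace M χ) :=
    exists_nontrivial_weightSpace_of_isSolvable k (radical k L) M
  let N : LieSubmodule k L M := weightSpaceOfIsLieTower k M χ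
  replace hχ : Nontrivial N := hχ
  have smul (x : L) (hx : x ∈ radical k L) (n : M) (hn : n ∈ N) : ⁅x, n⁆ = χ ⟨x, hx⟩ • n := by
    have hn : ∀ (y : L) (hy : y ∈ radical k L), ⁅y, n⁆ = χ ⟨y, hy⟩ • n := by
      simpa [N, weightSpaceOfIsLieTower, mem_weightSpace] using hn
    exact hn x hx
  refine ⟨N, (LieSubmodule.nontrivial_iff_ne_bot k L M).mp hχ, fun x hx hxD n hn ↦ ?_⟩
  have htr : LinearMap.trace k N (toEnd k L N x) = 0 :=
    trace_toEnd_eq_zero_of_mem_lcs k L N le_rfl hxD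
  have hscalar : toEnd k L N x = χ ⟨x, hx⟩ • LinearMap.id := by
    ext m
    simpa using smul x hx m m.2
  have hfin : finrank k N ≠ 0 := finrank_pos.ne'
  have hzero : χ ⟨x, hx⟩ = 0 := by
    simpa [hscalar, hfin] using htr
  rw [smul x hx n hn, hzero, zero_smul]

end

/-- If `x` lies in both the radical and the derived ideal then `x ∘ y` acts nilpotently on every
finite-dimensional module. -/
lemma isNilpotent_toEnd_mul_of_mem_radical {k L : Type*} [Field k] [CharZero k] [IsAlgClosed k]
    [LieRing L] [LieAlgebra k L] [Module.Finite k L]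
    (M : Type*) [AddCommGroup M] [Module k M] [LieRingModule L M] [LieModule k L M]
    [Module.Finite k M] {x : L} (hx : x ∈ radical k L) (hxD : x ∈ lowerCentralSeries k L L 1)
    (y : L) : _root_.IsNilpotent (toEnd k L M x * toEnd k L M y) := by
  obtain _ | _ := subsingleton_or_nontrivial M
  · exact ⟨1, LinearMap.ext fun m ↦ Subsingleton.elim _ _⟩
  obtain ⟨N, hN, hker⟩ := exists_ne_bot_forall_mem_radical_lie_eq_zero (k := k) (L := L) (M := M)
  have hlt : finrank k (M ⧸ N) < finrank k M := by
    have h₁ : finrank k (M ⧸ N) + finrank k N = finrank k M :=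
      N.toSubmodule.finrank_quotient_add_finrank
    have : Nontrivial N := (LieSubmodule.nontrivial_iff_ne_bot k L M).mpr hN
    have : 0 < finrank k N := finrank_pos
    lia
  obtain ⟨d, hd⟩ := isNilpotent_toEnd_mul_of_mem_radical (M ⧸ N) hx hxD y
  have hmk (m : M) : LieSubmodule.Quotient.mk' N (((toEnd k L M x * toEnd k L M y) ^ d) m) =
      ((toEnd k L (M ⧸ N) x * toEnd k L (M ⧸ N) y) ^ d) (LieSubmodule.Quotient.mk' N m) := by
    have hcomm : Function.Semiconj (LieSubmodule.Quotient.mk' N)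
        (toEnd k L M x * toEnd k L M y) (toEnd k L (M ⧸ N) x * toEnd k L (M ⧸ N) y) := fun m ↦ by
      simp only [Module.End.mul_apply, toEnd_apply_apply, LieModuleHom.map_lie]
    simpa only [Module.End.coe_pow] using hcomm.iterate_right d m
  refine ⟨d + 1, LinearMap.ext fun m ↦ ?_⟩
  have hm : ((toEnd k L M x * toEnd k L M y) ^ d) m ∈ N := by
    rw [← LieSubmodule.Quotient.mk_eq_zero, hmk m, hd, LinearMap.zero_apply]
  rw [pow_succ', Module.End.mul_apply, Module.End.mul_apply, toEnd_apply_apply, toEnd_apply_apply,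
    hker x hx hxD _ (N.lie_mem hm), LinearMap.zero_apply]
termination_by finrank k M

lemma traceForm_apply_eq_zero_of_mem_radical {k L : Type*} [Field k] [CharZero k] [IsAlgClosed k]
    [LieRing L] [LieAlgebra k L] [Module.Finite k L]
    (M : Type*) [AddCommGroup M] [Module k M] [LieRingModule L M] [LieModule k L M]
    [Module.Finite k M] {x : L} (hx : x ∈ radical k L) (hxD : x ∈ lowerCentralSeries k L L 1)
    (y : L) : traceForm k L M x y = 0 :=
  (LinearMap.isNilpotent_trace_of_isNilpotent
    (isNilpotent_toEnd_mul_of_mem_radical M hx hxD y)).eq_zero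

end LieModule

namespace LieAlgebra

open LieModule

lemma mem_center_of_forall_traceForm_lie_eq_zero {k L M : Type*} [Field k] [LieRing L]
    [LieAlgebra k L] [AddCommGroup M] [Module k M] [LieRingModule L M] [LieModule k L M]
    (hB : (traceForm k L M).Nondegenerate) {x : L} (hx : ∀ y z : L, traceForm k L M ⁅y, z⁆ x = 0) :
    x ∈ center k L := by
  refine (mem_maxTrivSubmodule k L L x).mpr fun y ↦ hB.1 _ fun z ↦ ?_
  rw [← lie_skew, map_neg, LinearMap.neg_apply, traceForm_apply_lie_apply, traceForm_comm, hx,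
    neg_zero]

variable {k L : Type*} [Field k] [LieRing L] [LieAlgebra k L]

/-- If the center and an ideal `D` together span, then ideals of `D` are ideals of the whole Lie
algebra, so that `D` has trivial radical as soon as it meets the radical trivially. -/
lemma hasTrivialRadical_of_codisjoint_center_of_disjoint_radical [IsNoetherian k L]
    (D : LieIdeal k L) (hZ : Codisjoint (center k L) D) (hR : Disjoint (radical k L) D) :
    HasTrivialRadical k D := by
  refine (hasTrivialRadical_iff_no_solvable_ideals k D).mpr fun J hJ ↦ ?_
  let I : LieIdeal k L :=
    { toSubmodule := J.toSubmodule.map D.toSubmodule.subtype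
      lie_mem := by
        rintro x _ ⟨j, hj, rfl⟩
        obtain ⟨z, hz, d, hd, rfl⟩ := (LieSubmodule.mem_sup _ _ x).mp
          (hZ.eq_top ▸ LieSubmodule.mem_top x)
        refine ⟨⁅(⟨d, hd⟩ : D), j⁆, J.lie_mem hj, ?_⟩
        have hzj : ⁅z, (j : L)⁆ = 0 := by
          rw [← lie_skew, (mem_maxTrivSubmodule k L L z).mp hz, neg_zero]
        change ⁅d, (j : L)⁆ = ⁅z + d, (j : L)⁆
        rw [add_lie, hzj, zero_add] }
  have mem_D (x : I) : (x : L) ∈ D := by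
    obtain ⟨_, j, -, rfl⟩ := x
    exact j.2
  have mem_J (x : I) : (⟨x, mem_D x⟩ : D) ∈ J := by
    obtain ⟨_, j, hj, rfl⟩ := x
    exact hj
  let f : I →ₗ⁅k⁆ J :=
    { toFun x := ⟨⟨x, mem_D x⟩, mem_J x⟩
      map_add' _ _ := rfl
      map_smul' _ _ := rfl
      map_lie' := rfl }
  have hf : Function.Injective f := fun x y hxy ↦
    Subtype.ext (congrArg (fun j : J ↦ ((j : D) : L)) hxy)
  have hI : I ≤ radical k L := (LieIdeal.solvable_iff_le_radical k L I).mp hf.lieAlgebra_isSolvable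
  refine (LieSubmodule.eq_bot_iff J).mpr fun j hj ↦ Subtype.ext ?_
  have hjI : (j : L) ∈ I := ⟨j, hj, rfl⟩
  exact (LieSubmodule.mem_bot _).mp (hR.le_bot ⟨hI hjI, j.2⟩)

/-- A Lie algebra admitting a finite-dimensional representation with non-degenerate trace form is
the direct sum of its center, which is its radical, and its derived ideal. -/
theorem radical_eq_center_and_isCompl_of_traceForm_nondegenerate [CharZero k] [IsAlgClosed k]
    [Module.Finite k L] (M : Type*) [AddCommGroup M] [Module k M] [LieRingModule L M]
    [LieModule k L M] [Module.Finite k M] (hB : (traceForm k L M).Nondegenerate) :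
    radical k L = center k L ∧ HasTrivialRadical k (lowerCentralSeries k L L 1) ∧
      IsCompl (center k L) (lowerCentralSeries k L L 1) := by
  let D : LieIdeal k L := lowerCentralSeries k L L 1
  have lie_mem_D (y z : L) : ⁅y, z⁆ ∈ D := by
    simpa [D] using LieSubmodule.lie_mem_lie (LieSubmodule.mem_top (R := k) (L := L) y)
      (LieSubmodule.mem_top (R := k) (L := L) z)
  have hRD : Disjoint (radical k L) D := by
    refine disjoint_iff_inf_le.mpr fun x hx ↦ (LieSubmodule.mem_bot _).mpr (hB.1 x fun y ↦ ?_)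
    exact traceForm_apply_eq_zero_of_mem_radical M hx.1 hx.2 y
  have hR : radical k L = center k L := by
    refine le_antisymm (fun x hx ↦ (mem_maxTrivSubmodule k L L x).mpr fun y ↦ ?_)
      (center_le_radical k L)
    exact (LieSubmodule.mem_bot _).mp (hRD.le_bot ⟨(radical k L).lie_mem hx, lie_mem_D y x⟩)
  have hZ : (center k L).toSubmodule = (traceForm k L M).orthogonal D.toSubmodule := by
    refine le_antisymm (fun z hz d hd ↦ ?_) (fun x hx ↦ ?_)
    · exact traceForm_apply_eq_zero_of_mem_lcs_of_mem_center k L M hd hz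
    · exact mem_center_of_forall_traceForm_lie_eq_zero hB fun y z ↦ hx _ (lie_mem_D y z)
  have hcompl : IsCompl (center k L) D := by
    rw [← LieSubmodule.isCompl_toSubmodule, hZ, isCompl_comm,
      LinearMap.BilinForm.isCompl_orthogonal_iff_disjoint (traceForm_isSymm k L M).isRefl, ← hZ,
      LieSubmodule.disjoint_toSubmodule, ← hR]
    exact hRD.symm
  exact ⟨hR, hasTrivialRadical_of_codisjoint_center_of_disjoint_radical D hcompl.codisjoint hRD,
    hcompl⟩

end LieAlgebra

/-- Let `g` be a finite-dimensional complex Lie algebra with Killing form `B`, and `h` a Lie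
subalgebra of `g` on which the restriction of `B` is non-degenerate. Then `h` is reductive:
the solvable radical of `h` equals the center of `h`, and `h` is the direct sum of its center
and a semisimple ideal. -/
theorem subalgebra_killing_nondegenerate_reductive_complex
    (g : Type*) [LieRing g] [LieAlgebra ℂ g] [FiniteDimensional ℂ g]
    (h : LieSubalgebra ℂ g)
    (hB : ((killingForm ℂ g).restrict h.toSubmodule).Nondegenerate) :
    LieAlgebra.radical ℂ h = LieAlgebra.center ℂ h ∧
      ∃ s : LieIdeal ℂ h, LieAlgebra.HasTrivialRadical ℂ s ∧
        IsCompl (LieAlgebra.center ℂ h) s := by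
  have hB' : (LieModule.traceForm ℂ h g).Nondegenerate := hB
  obtain ⟨hR, hs, hcompl⟩ :=
    LieAlgebra.radical_eq_center_and_isCompl_of_traceForm_nondegenerate g hB'
  exact ⟨hR, _, hs, hcompl⟩
end

section
/- Let g be a finite-dimensional real Lie algebra with Killing form B, and let h be a Lie subalgebra of g such that the restriction of B to h × h is non-degenerate. Then h is reductive; that is, the solvable radical of h equals the center of h, and h is the direct sum of its center and a semisimple ideal. -/
open Module LieAlgebra
open scoped TensorProduct

namespace LieModule

/-- If `I` is a solvable ideal of `L` and `k` is algebraically closed of characteristic zero, then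
on every finite-dimensional `L`-module, the composition of the actions of an element of
`I ⊓ ⁅L, L⁆` and of any element of `L` is nilpotent. -/
theorem isNilpotent_toEnd_mul_toEnd_of_mem_solvable_of_mem_lie {k L : Type*} [Field k] [CharZero k]
    [IsAlgClosed k] [LieRing L] [LieAlgebra k L] (I : LieIdeal k L) [IsSolvable I]
    (M : Type*) [AddCommGroup M] [Module k M] [LieRingModule L M] [LieModule k L M]
    [FiniteDimensional k M] {x : L} (hxI : x ∈ I)
    (hx : x ∈ ⁅(⊤ : LieIdeal k L), (⊤ : LieIdeal k L)⁆) (y : L) :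
    _root_.IsNilpotent (toEnd k L M x * toEnd k L M y) := by
  induction hn : finrank k M using Nat.strong_induction_on generalizing M with
  | _ n ih =>
  rcases subsingleton_or_nontrivial M with hM | hM
  · exact ⟨1, Subsingleton.elim _ _⟩
  obtain ⟨χ, hχ⟩ := exists_nontrivial_weightSpace_of_isSolvable k I M
  let W : LieSubmodule k L M := weightSpaceOfIsLieTower k M χ
  have hW : Nontrivial W := hχ
  have hscalar : toEnd k L W x = χ ⟨x, hxI⟩ • LinearMap.id := by
    ext ⟨m, hm⟩
    exact (mem_weightSpace (χ := χ) m).mp hm ⟨x, hxI⟩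
  have htrace : LinearMap.trace k W (toEnd k L W x) = 0 :=
    trace_toEnd_eq_zero_of_mem_lcs k L W le_rfl (hx : x ∈ lowerCentralSeries k L L 1)
  have hχx : χ ⟨x, hxI⟩ = 0 := by
    rw [hscalar, map_smul, LinearMap.trace_id, smul_eq_mul, mul_eq_zero] at htrace
    exact htrace.resolve_right (Nat.cast_ne_zero.mpr finrank_pos.ne')
  have hxW (m : M) (hm : m ∈ W) : ⁅x, m⁆ = 0 := by
    have := (mem_weightSpace (χ := χ) m).mp hm ⟨x, hxI⟩
    rw [hχx, zero_smul] at this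
    exact this
  have hlt : finrank k (M ⧸ W) < n := by
    have h1 := Submodule.finrank_quotient_add_finrank W.toSubmodule
    have h2 : 0 < finrank k W.toSubmodule := finrank_pos (M := W)
    change finrank k (M ⧸ W.toSubmodule) < n
    omega
  have : FiniteDimensional k (M ⧸ W) :=
    inferInstanceAs (FiniteDimensional k (M ⧸ W.toSubmodule))
  obtain ⟨d, hd⟩ := ih _ hlt (M ⧸ W) rfl
  have hmk (d : ℕ) (m : M) :
      LieSubmodule.Quotient.mk (N := W) (((toEnd k L M x * toEnd k L M y) ^ d) m) =
        ((toEnd k L (M ⧸ W) x * toEnd k L (M ⧸ W) y) ^ d)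
          (LieSubmodule.Quotient.mk (N := W) m) := by
    induction d with
    | zero => rfl
    | succ d ihd =>
      rw [pow_succ', pow_succ', Module.End.mul_apply, Module.End.mul_apply _ (_ ^ d), ← ihd]
      rfl
  refine ⟨d + 1, LinearMap.ext fun m ↦ ?_⟩
  rw [pow_succ', Module.End.mul_apply]
  refine hxW _ (W.lie_mem (LieSubmodule.Quotient.mk_eq_zero'.mp ?_))
  rw [hmk, hd]
  rfl

/-- Over a field of characteristic zero, if `I` is a solvable ideal of `L`, then `I ⊓ ⁅L, L⁆` is
contained in the kernel of the trace form of every finite-dimensional `L`-module. -/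
theorem traceForm_eq_zero_of_mem_solvable_of_mem_lie {k L : Type*} [Field k] [CharZero k]
    [LieRing L] [LieAlgebra k L] (I : LieIdeal k L) [IsSolvable I]
    (M : Type*) [AddCommGroup M] [Module k M] [LieRingModule L M] [LieModule k L M]
    [FiniteDimensional k M] {x : L} (hxI : x ∈ I)
    (hx : x ∈ ⁅(⊤ : LieIdeal k L), (⊤ : LieIdeal k L)⁆) :
    traceForm k L M x = 0 := by
  ext y
  let A := AlgebraicClosure k
  have hI : IsSolvable (I.baseChange A) := by
    obtain ⟨n, hn⟩ := IsSolvable.solvable k I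
    rw [LieIdeal.derivedSeries_eq_bot_iff] at hn
    refine IsSolvable.mk (R := A) (k := n) ((LieIdeal.derivedSeries_eq_bot_iff _ n).mpr ?_)
    rw [derivedSeriesOfIdeal_baseChange, hn, LieSubmodule.baseChange_bot]
  have hx' : (1 : A) ⊗ₜ[k] x ∈
      ⁅(⊤ : LieIdeal A (A ⊗[k] L)), (⊤ : LieIdeal A (A ⊗[k] L))⁆ := by
    rw [← LieSubmodule.baseChange_top, ← LieSubmodule.lie_baseChange]
    exact LieSubmodule.tmul_mem_baseChange_of_mem 1 hx
  have h := isNilpotent_toEnd_mul_toEnd_of_mem_solvable_of_mem_lie (I.baseChange A) (A ⊗[k] M)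
    (LieSubmodule.tmul_mem_baseChange_of_mem 1 hxI) hx' ((1 : A) ⊗ₜ[k] y)
  have h0 : traceForm A (A ⊗[k] L) (A ⊗[k] M) (1 ⊗ₜ x) (1 ⊗ₜ y) = 0 :=
    (LinearMap.isNilpotent_trace_of_isNilpotent h).eq_zero
  rw [traceForm_baseChange, LinearMap.BilinForm.baseChange_tmul] at h0
  simpa using h0

end LieModule

namespace LieAlgebra

/-- A finite-dimensional Lie algebra over a field of characteristic zero with a non-degenerate
trace form is the direct sum of its center, which is its radical, and a semisimple ideal. -/
theorem radical_eq_center_and_exists_isCompl_of_traceForm_nondegenerate {k L : Type*} [Field k]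
    [CharZero k] [LieRing L] [LieAlgebra k L] [FiniteDimensional k L]
    (M : Type*) [AddCommGroup M] [Module k M] [LieRingModule L M] [LieModule k L M]
    [FiniteDimensional k M] (hM : (LieModule.traceForm k L M).Nondegenerate) :
    radical k L = center k L ∧
      ∃ s : LieIdeal k L, HasTrivialRadical k s ∧ IsCompl (center k L) s := by
  have hker : LinearMap.ker (LieModule.traceForm k L M) = ⊥ :=
    LinearMap.separatingLeft_iff_ker_eq_bot.mp hM.1
  have hrad : radical k L = center k L := by
    refine le_antisymm (fun x hx ↦ ?_) (center_le_radical k L)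
    refine (LieModule.mem_maxTrivSubmodule k L L x).mpr fun y ↦ ?_
    rw [← Submodule.mem_bot k, ← hker]
    exact LieModule.traceForm_eq_zero_of_mem_solvable_of_mem_lie (radical k L) M
      ((radical k L).lie_mem hx)
      (LieSubmodule.lie_mem_lie (LieSubmodule.mem_top y) (LieSubmodule.mem_top x))
  let s : LieIdeal k L := ⁅(⊤ : LieIdeal k L), (⊤ : LieIdeal k L)⁆
  have hdisj : Disjoint s (center k L) := by
    rw [disjoint_iff_inf_le, ← LieSubmodule.toSubmodule_le_toSubmodule]
    refine le_trans (fun x hx ↦ ?_) hker.le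
    exact LieModule.traceForm_eq_zero_of_mem_solvable_of_mem_lie (center k L) M hx.2 hx.1
  have horth : (LieModule.traceForm k L M).orthogonal s.toSubmodule ≤
      (center k L).toSubmodule := by
    refine fun z hz ↦ (LieModule.mem_maxTrivSubmodule k L L z).mpr fun x ↦ ?_
    refine hM.2 _ fun y ↦ ?_
    rw [← LieModule.traceForm_apply_lie_apply]
    exact hz _ (LieSubmodule.lie_mem_lie (LieSubmodule.mem_top y) (LieSubmodule.mem_top x))
  have hcompl : IsCompl (center k L) s := by
    refine ⟨hdisj.symm, ?_⟩
    rw [codisjoint_iff, ← LieSubmodule.toSubmodule_inj, LieSubmodule.sup_toSubmodule,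
      LieSubmodule.top_toSubmodule, ← codisjoint_iff]
    refine Codisjoint.mono_left horth (IsCompl.codisjoint ?_).symm
    rw [LinearMap.BilinForm.isCompl_orthogonal_iff_disjoint
      (LieModule.traceForm_isSymm k L M).isRefl]
    exact (LieSubmodule.disjoint_toSubmodule.mpr hdisj).mono_right horth
  refine ⟨hrad, s, (hasTrivialRadical_iff_no_solvable_ideals k s).mpr fun J hJ ↦ ?_, hcompl⟩
  let J' : LieIdeal k L :=
    { toSubmodule := J.toSubmodule.map s.toSubmodule.subtype
      lie_mem := by
        rintro x _ ⟨j, hj, rfl⟩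
        obtain ⟨c, hc, t, ht, rfl⟩ := (LieSubmodule.mem_sup _ _ x).mp
          (hcompl.sup_eq_top ▸ LieSubmodule.mem_top x : x ∈ center k L ⊔ s)
        refine ⟨⁅(⟨t, ht⟩ : s), j⁆, J.lie_mem hj, ?_⟩
        have hcj : ⁅c, (j : L)⁆ = 0 := by
          rw [← lie_skew, (LieModule.mem_maxTrivSubmodule k L L c).mp hc, neg_zero]
        change ⁅t, (j : L)⁆ = ⁅c + t, (j : L)⁆
        rw [add_lie, hcj, zero_add] }
  have hJ' : IsSolvable J' := by
    let f : J →ₗ⁅k⁆ J' :=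
      { toFun := fun j ↦ ⟨j.1.1, j.1, j.2, rfl⟩
        map_add' := fun _ _ ↦ rfl
        map_smul' := fun _ _ ↦ rfl
        map_lie' := rfl }
    refine Function.Surjective.lieAlgebra_isSolvable (f := f) ?_
    rintro ⟨_, j, hj, rfl⟩
    exact ⟨⟨j, hj⟩, rfl⟩
  rw [LieSubmodule.eq_bot_iff]
  intro j hj
  have hjc : (j : L) ∈ center k L :=
    hrad ▸ (LieIdeal.solvable_iff_le_radical k L J').mp hJ' ⟨j, hj, rfl⟩
  have h0 : (j : L) ∈ (⊥ : LieIdeal k L) := hdisj.le_bot ⟨j.2, hjc⟩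
  exact Subtype.ext ((LieSubmodule.mem_bot _).mp h0)

end LieAlgebra

/-- Let `g` be a finite-dimensional real Lie algebra with Killing form `B`, and `h` a Lie
subalgebra of `g` on which the restriction of `B` is non-degenerate. Then `h` is reductive:
the solvable radical of `h` equals the center of `h`, and `h` is the direct sum of its center
and a semisimple ideal. -/
theorem subalgebra_killing_nondegenerate_reductive_real
    (g : Type*) [LieRing g] [LieAlgebra ℝ g] [FiniteDimensional ℝ g]
    (h : LieSubalgebra ℝ g)
    (hB : ((killingForm ℝ g).restrict h.toSubmodule).Nondegenerate) :
    LieAlgebra.radical ℝ h = LieAlgebra.center ℝ h ∧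
      ∃ s : LieIdeal ℝ h, LieAlgebra.HasTrivialRadical ℝ s ∧
        IsCompl (LieAlgebra.center ℝ h) s := by
  exact LieAlgebra.radical_eq_center_and_exists_isCompl_of_traceForm_nondegenerate g hB
end

section
/- Let g be a finite-dimensional complex Lie algebra with Killing form B, and let h be a Lie subalgebra of g on which B is non-degenerate. Let k denote the solvable radical of h. Then the restriction of B to k × k is non-degenerate. -/
open LieAlgebra LieModule in
/-- Over an algebraically closed field of characteristic zero, an element `x` of the radical of `L`
which lies in `⁅L, L⁆` acts nilpotently on every finite-dimensional module, even after composing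
with the action of any other element. -/
theorem isNilpotent_toEnd_mul_toEnd_of_mem_radical {K L : Type*} [Field K] [IsAlgClosed K]
    [CharZero K] [LieRing L] [LieAlgebra K L] [FiniteDimensional K L] (M : Type*) [AddCommGroup M]
    [Module K M] [LieRingModule L M] [LieModule K L M] [FiniteDimensional K M] {x : L}
    (hx : x ∈ radical K L) (hx' : x ∈ lowerCentralSeries K L L 1) (y : L) :
    IsNilpotent (toEnd K L M y * toEnd K L M x) := by
  rcases subsingleton_or_nontrivial M with _ | _
  · exact ⟨1, Subsingleton.elim _ _⟩
  obtain ⟨χ, hχ⟩ := exists_nontrivial_weightSpace_of_isSolvable K (radical K L) M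
  let N : LieSubmodule K L M := weightSpaceOfIsLieTower K M χ
  have hN : Nontrivial N := hχ
  have hxN (m : M) (hm : m ∈ N) : ⁅x, m⁆ = χ ⟨x, hx⟩ • m :=
    (mem_weightSpace (χ := χ) m).mp hm ⟨x, hx⟩
  have hχx : χ ⟨x, hx⟩ = 0 := by
    have htr := trace_toEnd_eq_zero_of_mem_lcs K L N le_rfl hx'
    have : toEnd K L N x = χ ⟨x, hx⟩ • LinearMap.id := by
      ext m
      exact hxN m m.2
    rw [this, map_smul, LinearMap.trace_id, smul_eq_mul, mul_eq_zero, Nat.cast_eq_zero] at htr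
    exact htr.resolve_right Module.finrank_pos.ne'
  have hlt : Module.finrank K (M ⧸ N) < Module.finrank K M := by
    have h1 := N.toSubmodule.finrank_quotient_add_finrank
    have h2 : 0 < Module.finrank K N := Module.finrank_pos
    change Module.finrank K (M ⧸ N.toSubmodule) < _
    change 0 < Module.finrank K N.toSubmodule at h2
    lia
  have : FiniteDimensional K (M ⧸ N) := inferInstanceAs (FiniteDimensional K (M ⧸ N.toSubmodule))
  obtain ⟨n, hn⟩ := isNilpotent_toEnd_mul_toEnd_of_mem_radical (M ⧸ N) hx hx' y
  have hmk (n : ℕ) (m : M) : LieSubmodule.Quotient.mk' N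
      (((toEnd K L M y * toEnd K L M x) ^ n) m) =
      ((toEnd K L (M ⧸ N) y * toEnd K L (M ⧸ N) x) ^ n) (LieSubmodule.Quotient.mk' N m) := by
    induction n with
    | zero => rfl
    | succ n ih =>
      rw [pow_succ', pow_succ', Module.End.mul_apply _ (_ ^ n), Module.End.mul_apply _ (_ ^ n),
        ← ih]
      rfl
  refine ⟨n + 1, LinearMap.ext fun m ↦ ?_⟩
  have hm : ((toEnd K L M y * toEnd K L M x) ^ n) m ∈ N := by
    rw [← LieSubmodule.Quotient.mk_eq_zero, hmk, hn, LinearMap.zero_apply]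
  simp [pow_succ', hxN _ hm, hχx]
termination_by Module.finrank K M

open LieAlgebra LieModule in
/-- If `L` has a finite-dimensional module with non-degenerate trace form then its radical is
disjoint from its derived ideal. -/
theorem disjoint_radical_lowerCentralSeries_one {K L M : Type*} [Field K] [IsAlgClosed K]
    [CharZero K] [LieRing L] [LieAlgebra K L] [FiniteDimensional K L] [AddCommGroup M]
    [Module K M] [LieRingModule L M] [LieModule K L M] [FiniteDimensional K M]
    (hB : (traceForm K L M).Nondegenerate) :
    Disjoint (radical K L) (lowerCentralSeries K L L 1) := by
  rw [disjoint_iff, LieSubmodule.eq_bot_iff]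
  rintro x ⟨hx, hx'⟩
  refine hB.2 x fun y ↦ ?_
  exact (LinearMap.isNilpotent_trace_of_isNilpotent
    (isNilpotent_toEnd_mul_toEnd_of_mem_radical M hx hx' y)).eq_zero

open LieAlgebra LieModule in
/-- A non-degenerate trace form of `L` is non-degenerate on the radical of `L`. -/
theorem traceForm_restrict_radical_nondegenerate {K L M : Type*} [Field K] [IsAlgClosed K]
    [CharZero K] [LieRing L] [LieAlgebra K L] [FiniteDimensional K L] [AddCommGroup M]
    [Module K M] [LieRingModule L M] [LieModule K L M] [FiniteDimensional K M]
    (hB : (traceForm K L M).Nondegenerate) :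
    ((traceForm K L M).restrict (radical K L).toSubmodule).Nondegenerate := by
  let D := (lowerCentralSeries K L L 1).toSubmodule
  have hlie (a b : L) : ⁅a, b⁆ ∈ lowerCentralSeries K L L 1 := by
    rw [lowerCentralSeries_succ]
    exact LieSubmodule.lie_mem_lie (LieSubmodule.mem_top a) (LieSubmodule.mem_top b)
  have hdisj (x : L) (hx : x ∈ radical K L) (hx' : x ∈ lowerCentralSeries K L L 1) : x = 0 := by
    have := (disjoint_radical_lowerCentralSeries_one hB).le_bot
    simpa using this ⟨hx, hx'⟩
  have hrefl : (traceForm K L M).IsRefl := (traceForm_isSymm K L M).isRefl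
  have horth : (traceForm K L M).orthogonal D ≤ (radical K L).toSubmodule := by
    intro x hx
    refine center_le_radical K L ?_
    rw [mem_maxTrivSubmodule]
    refine fun a ↦ hB.2 _ fun b ↦ ?_
    rw [← traceForm_apply_lie_apply]
    exact hx _ (hlie b a)
  refine LinearMap.BilinForm.nondegenerate_restrict_of_disjoint_orthogonal _ hrefl ?_
  rw [disjoint_iff, Submodule.eq_bot_iff]
  rintro x ⟨hx, hx'⟩
  refine hdisj x hx ?_
  change x ∈ D
  rw [← LinearMap.BilinForm.orthogonal_orthogonal hB hrefl D]
  exact LinearMap.BilinForm.orthogonal_le horth hx'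

/-- Let `g` be a finite-dimensional complex Lie algebra with Killing form `B` and `h` a Lie
subalgebra of `g` on which `B` is non-degenerate.  Then `B` is also non-degenerate on the
solvable radical `k` of `h`. -/
theorem killing_nondegenerate_on_radical
    (g : Type*) [LieRing g] [LieAlgebra ℂ g] [FiniteDimensional ℂ g]
    (h : LieSubalgebra ℂ g)
    (hB : ((killingForm ℂ g).restrict h.toSubmodule).Nondegenerate) :
    ((killingForm ℂ g).restrict
      (((LieAlgebra.radical ℂ h).toSubmodule).map h.incl.toLinearMap)).Nondegenerate := by
  obtain ⟨hl, hr⟩ := traceForm_restrict_radical_nondegenerate (L := h) (M := g) hB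
  constructor
  · rintro ⟨_, x, hx, rfl⟩ hxy
    have := hl ⟨x, hx⟩ fun y ↦ hxy ⟨_, y, y.2, rfl⟩
    simpa using this
  · rintro ⟨_, x, hx, rfl⟩ hxy
    have := hr ⟨x, hx⟩ fun y ↦ hxy ⟨_, y, y.2, rfl⟩
    simpa using this
end

section
/- Let g be a finite-dimensional complex Lie algebra with Killing form B, let h be a Lie subalgebra of g on which B is non-degenerate, and let k be the solvable radical of h. Then the ideal l = k ∩ k^⊥ of h is abelian, where k^⊥ = {x ∈ h : B(x, y) = 0 for all y ∈ k}. -/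
/-- Let `g` be a finite-dimensional complex Lie algebra with Killing form `B`, `h` a Lie
subalgebra of `g` on which `B` is non-degenerate, and `k` the solvable radical of `h`.
Then the ideal `l = k ∩ k^⊥` of `h` is abelian, where
`k^⊥ = {x ∈ h : B(x, y) = 0 for all y ∈ k}`. -/
theorem radical_inter_orthogonal_abelian
    (g : Type*) [LieRing g] [LieAlgebra ℂ g] [FiniteDimensional ℂ g]
    (h : LieSubalgebra ℂ g)
    (hB : ((killingForm ℂ g).restrict h.toSubmodule).Nondegenerate) :
    ∀ x y : h,
      x ∈ LieAlgebra.radical ℂ h → (∀ z ∈ LieAlgebra.radical ℂ h, killingForm ℂ g x z = 0) →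
      y ∈ LieAlgebra.radical ℂ h → (∀ z ∈ LieAlgebra.radical ℂ h, killingForm ℂ g y z = 0) →
      ⁅x, y⁆ = 0 := by
  intro x y _ hxk hy _
  refine hB.1 ⁅x, y⁆ fun z => ?_
  have hyz : ⁅y, z⁆ ∈ LieAlgebra.radical ℂ h := lie_mem_left ℂ h _ y z hy
  change killingForm ℂ g ⁅(x : g), (y : g)⁆ z = 0
  rw [LieModule.traceForm_apply_lie_apply]
  exact hxk _ hyz
end

section
/- Let g be a finite-dimensional complex Lie algebra with Killing form B, and let h be a Lie subalgebra of g on which B is non-degenerate. Then the solvable radical k of h is abelian. -/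
namespace LieModule

variable {K L : Type*} [Field K] [CharZero K] [IsAlgClosed K] [LieRing L] [LieAlgebra K L]

/-- If `A` is a solvable ideal of `L`, then on any nontrivial finite-dimensional `L`-module, `⁅L, A⁆`
annihilates some nontrivial submodule. -/
theorem exists_ne_bot_lie_lie_eq_zero_of_isSolvable (A : LieIdeal K L) [LieAlgebra.IsSolvable A]
    (V : Type*) [AddCommGroup V] [Module K V] [LieRingModule L V] [LieModule K L V]
    [FiniteDimensional K V] [Nontrivial V] :
    ∃ N : LieSubmodule K L V, N ≠ ⊥ ∧ ∀ (x : L), ∀ a ∈ A, ∀ v ∈ N, ⁅⁅x, a⁆, v⁆ = 0 := by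
  obtain ⟨χ, hχ⟩ := exists_nontrivial_weightSpace_of_isSolvable K A V
  let N : LieSubmodule K L V := weightSpaceOfIsLieTower K V χ
  have hN : ∀ a (ha : a ∈ A), ∀ v ∈ N, ⁅a, v⁆ = χ ⟨a, ha⟩ • v := fun a ha v hv ↦
    (mem_weightSpace (χ := χ) v).mp hv ⟨a, ha⟩
  have : Nontrivial N := hχ
  refine ⟨N, (LieSubmodule.nontrivial_iff_ne_bot K L V).mp this, fun x a ha v hv ↦ ?_⟩
  rw [lie_lie, hN a ha v hv, hN a ha _ (N.lie_mem hv), lie_smul, sub_self]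

/-- If `A` is a solvable ideal of `L`, then on any finite-dimensional `L`-module, the composition of
an element of `L` with an element of the form `⁅y, a⁆`, where `a ∈ A`, acts nilpotently. -/
theorem isNilpotent_toEnd_mul_toEnd_lie_of_isSolvable (A : LieIdeal K L) [LieAlgebra.IsSolvable A]
    (V : Type*) [AddCommGroup V] [Module K V] [LieRingModule L V] [LieModule K L V]
    [FiniteDimensional K V] (x y : L) {a : L} (ha : a ∈ A) :
    _root_.IsNilpotent (toEnd K L V x * toEnd K L V ⁅y, a⁆) := by
  obtain _ | _ := subsingleton_or_nontrivial V
  · exact ⟨1, Subsingleton.elim _ _⟩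
  obtain ⟨N, hN, hyN⟩ := exists_ne_bot_lie_lie_eq_zero_of_isSolvable A V
  obtain ⟨k, hk⟩ := isNilpotent_toEnd_mul_toEnd_lie_of_isSolvable A (V ⧸ N) x y ha
  refine ⟨k + 1, LinearMap.ext fun v ↦ ?_⟩
  have hmk (n : ℕ) : LieSubmodule.Quotient.mk (N := N)
      (((toEnd K L V x * toEnd K L V ⁅y, a⁆) ^ n) v) =
      ((toEnd K L (V ⧸ N) x * toEnd K L (V ⧸ N) ⁅y, a⁆) ^ n) (LieSubmodule.Quotient.mk v) := by
    induction n with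
    | zero => simp
    | succ n ih =>
      simp only [pow_succ', Module.End.mul_apply (_ * _), ← ih]
      rfl
  have hmem : ((toEnd K L V x * toEnd K L V ⁅y, a⁆) ^ k) v ∈ N := by
    rw [← LieSubmodule.Quotient.mk_eq_zero', hmk, hk, LinearMap.zero_apply]
  rw [pow_succ', Module.End.mul_apply, Module.End.mul_apply, toEnd_apply_apply K L V ⁅y, a⁆,
    hyN y a ha _ hmem, map_zero, LinearMap.zero_apply]
termination_by Module.finrank K V
decreasing_by
  have := N.toSubmodule.finrank_quotient_add_finrank
  have : 0 < Module.finrank K N.toSubmodule := by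
    rw [Nat.pos_iff_ne_zero, ne_eq, Submodule.finrank_eq_zero]
    simpa using hN
  change Module.finrank K (V ⧸ N.toSubmodule) < _
  lia

/-- If `A` is a solvable ideal of `L`, then `⁅L, A⁆` lies in the kernel of the trace form of any
finite-dimensional `L`-module. -/
theorem traceForm_apply_lie_eq_zero_of_isSolvable (A : LieIdeal K L) [LieAlgebra.IsSolvable A]
    (V : Type*) [AddCommGroup V] [Module K V] [LieRingModule L V] [LieModule K L V]
    [FiniteDimensional K V] (x y : L) {a : L} (ha : a ∈ A) :
    traceForm K L V x ⁅y, a⁆ = 0 :=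
  (LinearMap.isNilpotent_trace_of_isNilpotent
    (isNilpotent_toEnd_mul_toEnd_lie_of_isSolvable A V x y ha)).eq_zero

end LieModule

/-- Let `g` be a finite-dimensional complex Lie algebra with Killing form `B` and `h` a Lie
subalgebra of `g` on which `B` is non-degenerate.  Then the solvable radical of `h` is
abelian. -/
theorem radical_abelian_of_killing_nondegenerate
    (g : Type*) [LieRing g] [LieAlgebra ℂ g] [FiniteDimensional ℂ g]
    (h : LieSubalgebra ℂ g)
    (hB : ((killingForm ℂ g).restrict h.toSubmodule).Nondegenerate) :
    IsLieAbelian (LieAlgebra.radical ℂ h) := by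
  refine ⟨fun a b ↦ Subtype.ext (hB.2 _ fun x ↦ ?_)⟩
  exact LieModule.traceForm_apply_lie_eq_zero_of_isSolvable
    (LieAlgebra.radical ℂ h) g x (a : h) b.2
end

section
/- Let g be a finite-dimensional complex Lie algebra with Killing form B, let h be a Lie subalgebra of g on which B is non-degenerate, and let k be the solvable radical of h. Then the orthogonal complement k^⊥ = {x ∈ h : B(x,y) = 0 for all y ∈ k} is a semisimple ideal of h, h = k^⊥ ⊕ k as vector spaces, and [k^⊥, k] = 0; hence h is the Lie algebra direct product of the semisimple algebra k^⊥ with the abelian algebra k. -/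
open LieModule in
/-- An element which lies both in a solvable ideal and in the derived ideal acts on any
finite-dimensional module in such a way that its product with the action of any other element is
nilpotent. -/
theorem LieModule.isNilpotent_toEnd_mul_toEnd_of_mem_isSolvable
    (K L M : Type*) [Field K] [CharZero K] [IsAlgClosed K]
    [LieRing L] [LieAlgebra K L] [AddCommGroup M] [Module K M] [LieRingModule L M]
    [LieModule K L M] [FiniteDimensional K M]
    (I : LieIdeal K L) [LieAlgebra.IsSolvable I] (y z : L) (hy : y ∈ I)
    (hy' : y ∈ lowerCentralSeries K L L 1) :
    _root_.IsNilpotent (toEnd K L M y * toEnd K L M z) := by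
  rcases subsingleton_or_nontrivial M with hM | hM
  · exact ⟨1, Subsingleton.elim _ _⟩
  obtain ⟨χ, hχ⟩ := exists_nontrivial_weightSpace_of_isSolvable K I M
  let W : LieSubmodule K L M := weightSpaceOfIsLieTower K M χ
  have hW (a : L) (ha : a ∈ I) (m : M) (hm : m ∈ W) : ⁅a, m⁆ = χ ⟨a, ha⟩ • m :=
    (mem_weightSpace χ m).1 hm ⟨a, ha⟩
  have hWn : Nontrivial W := hχ
  have hχ0 : χ ⟨y, hy⟩ = 0 := by
    have h1 : toEnd K L W y = χ ⟨y, hy⟩ • 1 := by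
      ext m
      simpa using hW _ hy m m.2
    have h2 : LinearMap.trace K W (toEnd K L W y) = 0 :=
      trace_toEnd_eq_zero_of_mem_lcs K L W le_rfl hy'
    rw [h1, map_smul, LinearMap.trace_one, smul_eq_mul, mul_eq_zero] at h2
    exact h2.resolve_right (by exact_mod_cast Module.finrank_pos.ne')
  have hlt : Module.finrank K (M ⧸ W) < Module.finrank K M := by
    have h1 := Submodule.finrank_quotient_add_finrank W.toSubmodule
    have h2 : 0 < Module.finrank K W.toSubmodule := Module.finrank_pos (M := W)
    change Module.finrank K (M ⧸ W.toSubmodule) < _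
    omega
  obtain ⟨n, hn⟩ := isNilpotent_toEnd_mul_toEnd_of_mem_isSolvable K L (M ⧸ W) I y z hy hy'
  have hmk (j : ℕ) (m : M) :
      LieSubmodule.Quotient.mk' W (((toEnd K L M y * toEnd K L M z) ^ j) m) =
        ((toEnd K L (M ⧸ W) y * toEnd K L (M ⧸ W) z) ^ j) (LieSubmodule.Quotient.mk' W m) := by
    induction j with
    | zero => simp
    | succ j ih =>
      simp only [pow_succ', Module.End.mul_apply] at ih ⊢
      rw [← ih]
      rfl
  refine ⟨n + 1, LinearMap.ext fun m ↦ ?_⟩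
  have hm : ((toEnd K L M y * toEnd K L M z) ^ n) m ∈ W := by
    rw [← LieSubmodule.Quotient.mk_eq_zero, hmk, hn, LinearMap.zero_apply]
  rw [pow_succ', Module.End.mul_apply, Module.End.mul_apply, toEnd_apply_apply, toEnd_apply_apply,
    hW _ hy _ (W.lie_mem hm), hχ0, zero_smul, LinearMap.zero_apply]
termination_by Module.finrank K M

section

variable {K L M : Type*} [Field K] [CharZero K] [IsAlgClosed K]
  [LieRing L] [LieAlgebra K L] [FiniteDimensional K L]
  [AddCommGroup M] [Module K M] [LieRingModule L M] [LieModule K L M] [FiniteDimensional K M]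

theorem LieModule.traceForm_apply_eq_zero_of_mem_radical_s13 {y : L}
    (hy : y ∈ LieAlgebra.radical K L) (hy' : y ∈ lowerCentralSeries K L L 1) (z : L) :
    traceForm K L M y z = 0 :=
  (LinearMap.isNilpotent_trace_of_isNilpotent
    (isNilpotent_toEnd_mul_toEnd_of_mem_isSolvable K L M _ y z hy hy')).eq_zero

/-- If some trace form is nondegenerate then the solvable radical is central. -/
theorem LieModule.radical_eq_center_of_traceForm_nondegenerate
    (hB : (traceForm K L M).Nondegenerate) :
    LieAlgebra.radical K L = LieAlgebra.center K L := by
  refine le_antisymm (fun y hy ↦ ?_) (LieAlgebra.center_le_radical K L)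
  rw [LieModule.mem_maxTrivSubmodule]
  refine fun x ↦ hB.1 _ fun z ↦ ?_
  refine traceForm_apply_eq_zero_of_mem_radical_s13 (lie_mem_right K L _ x y hy) ?_ z
  rw [lowerCentralSeries_succ]
  exact LieSubmodule.lie_mem_lie (LieSubmodule.mem_top x) (LieSubmodule.mem_top y)

/-- If some trace form is nondegenerate then the radical and its orthogonal complement are
complementary. -/
theorem LieModule.isCompl_orthogonal_radical_of_traceForm_nondegenerate
    (hB : (traceForm K L M).Nondegenerate) :
    IsCompl (LinearMap.BilinForm.orthogonal (traceForm K L M) (LieAlgebra.radical K L).toSubmodule)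
      (LieAlgebra.radical K L).toSubmodule := by
  have hrefl : (traceForm K L M).IsRefl := (traceForm_isSymm K L M).isRefl
  have hrad := radical_eq_center_of_traceForm_nondegenerate hB
  have hD : (LieAlgebra.radical K L).toSubmodule = LinearMap.BilinForm.orthogonal
      (traceForm K L M) (lowerCentralSeries K L L 1).toSubmodule := by
    rw [hrad]
    ext y
    rw [LinearMap.BilinForm.mem_orthogonal_iff, LieSubmodule.mem_toSubmodule,
      LieModule.mem_maxTrivSubmodule]
    constructor
    · intro hy
      change (lowerCentralSeries K L L 1).toSubmodule ≤ LinearMap.ker ((traceForm K L M).flip y)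
      rw [lowerCentralSeries_succ, LieSubmodule.lieIdeal_oper_eq_linear_span', Submodule.span_le]
      rintro _ ⟨a, -, b, -, rfl⟩
      change traceForm K L M ⁅a, b⁆ y = 0
      rw [traceForm_apply_lie_apply, hy, map_zero]
    · refine fun hy x ↦ hB.2 _ fun z ↦ ?_
      rw [← traceForm_apply_lie_apply]
      refine hy _ ?_
      rw [lowerCentralSeries_succ]
      exact LieSubmodule.lie_mem_lie (LieSubmodule.mem_top _) (LieSubmodule.mem_top _)
  have hdisj : Disjoint (LieAlgebra.radical K L).toSubmodule
      (LinearMap.BilinForm.orthogonal (traceForm K L M)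
        (LieAlgebra.radical K L).toSubmodule) := by
    nth_rw 2 [hD]
    rw [LinearMap.BilinForm.orthogonal_orthogonal hB hrefl, Submodule.disjoint_def]
    exact fun y hy hy' ↦ hB.1 _ (traceForm_apply_eq_zero_of_mem_radical_s13 hy hy')
  exact ((LinearMap.BilinForm.isCompl_orthogonal_iff_disjoint hrefl).2 hdisj).symm

end

/-- An ideal which is complementary to a central radical has trivial radical. -/
theorem LieAlgebra.hasTrivialRadical_of_isCompl_radical
    {K L : Type*} [CommRing K] [LieRing L] [LieAlgebra K L] [IsNoetherian K L]
    (p : LieIdeal K L) (hp : IsCompl p.toSubmodule (radical K L).toSubmodule)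
    (hrad : radical K L = center K L) :
    HasTrivialRadical K p := by
  refine hasTrivialRadical_of_no_solvable_ideals fun J hJ ↦ ?_
  let J' : LieIdeal K L :=
    { J.toSubmodule.map p.toSubmodule.subtype with
      lie_mem := by
        rintro x _ ⟨m, hm, rfl⟩
        obtain ⟨a, ha, b, hb, rfl⟩ :=
          Submodule.mem_sup.1 (hp.sup_eq_top ▸ Submodule.mem_top (x := x))
        refine ⟨⁅(⟨a, ha⟩ : p), m⁆, lie_mem_right K p J _ m hm, ?_⟩
        rw [hrad] at hb
        have hbm : ⁅b, (m : L)⁆ = 0 := by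
          rw [← lie_skew, (LieModule.mem_maxTrivSubmodule K L L b).1 hb, neg_zero]
        change ⁅a, (m : L)⁆ = ⁅a + b, (m : L)⁆
        rw [add_lie, hbm, add_zero] }
  have hmem (x : L) (hx : x ∈ J') : ∃ hxp : x ∈ p, (⟨x, hxp⟩ : p) ∈ J := by
    obtain ⟨m, hm, rfl⟩ := hx
    exact ⟨m.2, hm⟩
  let f : J' →ₗ⁅K⁆ J :=
    { toFun := fun x ↦ ⟨⟨x, (hmem x x.2).1⟩, (hmem x x.2).2⟩
      map_add' := fun _ _ ↦ rfl
      map_smul' := fun _ _ ↦ rfl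
      map_lie' := rfl }
  have hf : Function.Injective f := fun a b hab ↦
    Subtype.ext (congrArg (fun c : J ↦ ((c : p) : L)) hab)
  have hJ' : J' ≤ radical K L := (LieIdeal.solvable_iff_le_radical K L J').1 hf.lieAlgebra_isSolvable
  rw [LieSubmodule.eq_bot_iff]
  intro m hm
  exact Subtype.ext (Submodule.disjoint_def.1 hp.disjoint m m.2 (hJ' ⟨m, hm, rfl⟩))

/-- Let `g` be a finite-dimensional complex Lie algebra with Killing form `B`, `h` a Lie
subalgebra of `g` on which `B` is non-degenerate, and `k` the solvable radical of `h`.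
Then the orthogonal complement `k^⊥ = {x ∈ h : B(x,y) = 0 ∀ y ∈ k}` is a semisimple ideal
of `h`, `h = k^⊥ ⊕ k` as vector spaces, and `[k^⊥, k] = 0`; hence `h` is the Lie algebra
direct product of the semisimple algebra `k^⊥` with the abelian algebra `k`. -/
theorem subalgebra_killing_nondegenerate_direct_product
    (g : Type*) [LieRing g] [LieAlgebra ℂ g] [FiniteDimensional ℂ g]
    (h : LieSubalgebra ℂ g)
    (hB : ((killingForm ℂ g).restrict h.toSubmodule).Nondegenerate) :
    ∃ p : LieIdeal ℂ h,
      (∀ x : h, x ∈ p ↔ ∀ y ∈ LieAlgebra.radical ℂ h, killingForm ℂ g x y = 0) ∧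
      LieAlgebra.HasTrivialRadical ℂ p ∧
      IsCompl p.toSubmodule (LieAlgebra.radical ℂ h).toSubmodule ∧
      (∀ x ∈ p, ∀ y ∈ LieAlgebra.radical ℂ h, ⁅x, y⁆ = (0 : h)) ∧
      IsLieAbelian (LieAlgebra.radical ℂ h) := by
  have hB' : (LieModule.traceForm ℂ h g).Nondegenerate := hB
  have hrad := LieModule.radical_eq_center_of_traceForm_nondegenerate hB'
  have hcompl := LieModule.isCompl_orthogonal_radical_of_traceForm_nondegenerate hB'
  have hcentral (x y : h) (hy : y ∈ LieAlgebra.radical ℂ h) : ⁅x, y⁆ = 0 := by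
    rw [hrad] at hy
    exact (LieModule.mem_maxTrivSubmodule ℂ h h y).1 hy x
  refine ⟨LieAlgebra.InvariantForm.orthogonal _ (LieModule.traceForm_lieInvariant ℂ h g)
    (LieAlgebra.radical ℂ h), fun x ↦ ?_,
    LieAlgebra.hasTrivialRadical_of_isCompl_radical _ hcompl hrad, hcompl,
    fun x _ y hy ↦ hcentral x y hy, ⟨fun x y ↦ Subtype.ext (hcentral x y y.2)⟩⟩
  rw [LieAlgebra.InvariantForm.mem_orthogonal]
  refine forall₂_congr fun y _ ↦ ?_
  rw [LieModule.traceForm_comm]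
  rfl
end
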